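/- arXiv:1401.4927 — 3 statements merged into one kernel-verified Lean document; each statement's English description precedes it below -/
import Mathlib

section
/- (Proposition on balanced games, part 1.) If a matrix game u : Fin m → Fin n → ℝ with entries in {0,1} is balanced (all rows have equal sum and all columns have equal sum), then 𝒱(u) = floor(u) = ceil(u). -/
open Finset

/-- A mixed strategy over a finite index type: nonnegative weights summing to 1. -/
def IsMixed {α : Type*} [Fintype α] (μ : α → ℝ) : Prop :=
  (∀ i, 0 ≤ μ i) ∧ ∑ i, μ i = 1

/-- Expected utility for Eloise when she plays mixed strategy `μ` (rows)
and Abelard plays mixed strategy `ν` (columns) in the matrix game `u`. -/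
noncomputable def EU {α β : Type*} [Fintype α] [Fintype β]
    (u : α → β → ℝ) (μ : α → ℝ) (ν : β → ℝ) : ℝ :=
  ∑ i, ∑ j, μ i * ν j * u i j

/-- The value of the matrix game `u`:
sup over Eloise's mixed strategies of the inf over Abelard's mixed strategies
of the expected utility. -/
noncomputable def gameValue {α β : Type*} [Fintype α] [Fintype β]
    (u : α → β → ℝ) : ℝ :=
  ⨆ μ : {μ : α → ℝ // IsMixed μ}, ⨅ ν : {ν : β → ℝ // IsMixed ν}, EU u μ.1 ν.1

theorem isMixed_uniform {α : Type*} [Fintype α] [Nonempty α] :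
    IsMixed fun _ : α => (Fintype.card α : ℝ)⁻¹ :=
  ⟨fun _ => by positivity, by simp⟩

section

variable {α β : Type*} [Fintype α] [Fintype β] {u : α → β → ℝ}

theorem EU_nonneg {μ : α → ℝ} {ν : β → ℝ} (hu : ∀ i j, 0 ≤ u i j)
    (hμ : IsMixed μ) (hν : IsMixed ν) : 0 ≤ EU u μ ν :=
  sum_nonneg fun i _ => sum_nonneg fun j _ =>
    mul_nonneg (mul_nonneg (hμ.1 i) (hν.1 j)) (hu i j)

theorem EU_uniform_right {μ : α → ℝ} {r : ℝ} (hμ : IsMixed μ)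
    (hr : ∀ i, ∑ j, u i j = r) :
    EU u μ (fun _ => (Fintype.card β : ℝ)⁻¹) = r / Fintype.card β := by
  simp_rw [EU, ← mul_sum, hr, ← sum_mul, hμ.2]
  rw [one_mul, div_eq_inv_mul]

theorem EU_uniform_left {ν : β → ℝ} {c : ℝ} (hν : IsMixed ν)
    (hc : ∀ j, ∑ i, u i j = c) :
    EU u (fun _ => (Fintype.card α : ℝ)⁻¹) ν = c / Fintype.card α := by
  rw [EU, sum_comm]
  simp_rw [← mul_sum, hc, ← sum_mul, ← mul_sum, hν.2]
  rw [mul_one, div_eq_inv_mul]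

/-- The uniform strategies are optimal in a game with constant row sums and constant column
sums. -/
theorem gameValue_eq_of_sums_eq [Nonempty α] [Nonempty β] {r c : ℝ}
    (hu : ∀ i j, 0 ≤ u i j) (hr : ∀ i, ∑ j, u i j = r) (hc : ∀ j, ∑ i, u i j = c) :
    gameValue u = c / Fintype.card α ∧ gameValue u = r / Fintype.card β := by
  let μ₀ : {μ : α → ℝ // IsMixed μ} := ⟨_, isMixed_uniform⟩
  let ν₀ : {ν : β → ℝ // IsMixed ν} := ⟨_, isMixed_uniform⟩
  have : Nonempty {μ : α → ℝ // IsMixed μ} := ⟨μ₀⟩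
  have : Nonempty {ν : β → ℝ // IsMixed ν} := ⟨ν₀⟩
  have heq : c / Fintype.card α = r / Fintype.card β :=
    (EU_uniform_left ν₀.2 hc).symm.trans (EU_uniform_right μ₀.2 hr)
  have hle : ∀ μ : {μ : α → ℝ // IsMixed μ},
      ⨅ ν : {ν : β → ℝ // IsMixed ν}, EU u μ.1 ν.1 ≤ r / Fintype.card β := fun μ =>
    (ciInf_le ⟨0, Set.forall_mem_range.2 fun ν => EU_nonneg hu μ.2 ν.2⟩ ν₀).trans_eq
      (EU_uniform_right μ.2 hr)
  have hvalue : gameValue u = r / Fintype.card β := by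
    refine le_antisymm (ciSup_le hle) ?_
    refine le_ciSup_of_le ⟨_, Set.forall_mem_range.2 hle⟩ μ₀ (le_ciInf fun ν => ?_)
    exact (heq.symm.trans (EU_uniform_left ν.2 hc).symm).le
  exact ⟨hvalue.trans heq.symm, hvalue⟩

end

/-- For a balanced game (all rows have equal sum, all columns have equal sum),
`𝒱(u) = floor(u) = ceil(u)`. -/
theorem value_of_balanced (m n : ℕ) (hm : 1 ≤ m) (hn : 1 ≤ n)
    (u : Fin m → Fin n → ℝ) (hu : ∀ i j, u i j = 0 ∨ u i j = 1)
    (hrow : ∀ i i' : Fin m, ∑ j, u i j = ∑ j, u i' j)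
    (hcol : ∀ j j' : Fin n, ∑ i, u i j = ∑ i, u i j') :
    gameValue u = (⨅ j : Fin n, ∑ i, u i j) / m
      ∧ gameValue u = (⨆ i : Fin m, ∑ j, u i j) / n := by
  have : NeZero m := ⟨by omega⟩
  have : NeZero n := ⟨by omega⟩
  have hu' : ∀ i j, 0 ≤ u i j := fun i j => by
    rcases hu i j with h | h <;> simp [h]
  have hinf : ⨅ j : Fin n, ∑ i, u i j = ∑ i, u i 0 := by
    simp_rw [fun j => hcol j 0, ciInf_const]
  have hsup : ⨆ i : Fin m, ∑ j, u i j = ∑ j, u 0 j := by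
    simp_rw [fun i => hrow i 0, ciSup_const]
  rw [hinf, hsup]
  simpa using gameValue_eq_of_sums_eq hu' (fun i => hrow i 0) (fun j => hcol j 0)
end

section
/- (Proposition on balanced row submatrices, part 1.) Let u : Fin m → Fin n → ℝ be a matrix game with entries in {0,1} and let S ⊆ Fin m be a nonempty set of rows whose induced row submatrix u' is balanced. If rowmax(u) = rowmax(u'), i.e. the maximum row sum over all rows of u equals the maximum row sum over the rows in S, then 𝒱(u) = 𝒱(u'), where 𝒱(u') is the value of the game restricted to rows S. -/
open Finset

theorem EU_eq_sum_row {α β : Type*} [Fintype α] [Fintype β] (u : α → β → ℝ)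
    (μ : α → ℝ) (ν : β → ℝ) : EU u μ ν = ∑ i, μ i * ∑ j, ν j * u i j := by
  simp only [EU, Finset.mul_sum, mul_assoc]

theorem EU_eq_sum_col {α β : Type*} [Fintype α] [Fintype β] (u : α → β → ℝ)
    (μ : α → ℝ) (ν : β → ℝ) : EU u μ ν = ∑ j, ν j * ∑ i, μ i * u i j := by
  rw [EU, Finset.sum_comm]
  simp only [Finset.mul_sum]
  exact Finset.sum_congr rfl fun j _ => Finset.sum_congr rfl fun i _ => by ring

theorem bddBelow_range_EU {α β : Type*} [Fintype α] [Fintype β] (u : α → β → ℝ) (μ : α → ℝ) :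
    BddBelow (Set.range fun ν : {ν : β → ℝ // IsMixed ν} => EU u μ ν.1) := by
  have hcont : Continuous fun ν : β → ℝ => EU u μ ν := by
    unfold EU
    fun_prop
  refine ((isCompact_stdSimplex ℝ β).bddBelow_image hcont.continuousOn).mono ?_
  rintro _ ⟨ν, rfl⟩
  exact ⟨ν.1, ν.2, rfl⟩

/-- Strategies for both players guaranteeing the same amount `v` certify that `v` is the value. -/
theorem gameValue_eq_of_guarantees {α β : Type*} [Fintype α] [Fintype β] {u : α → β → ℝ} {v : ℝ}
    {μ₀ : α → ℝ} (hμ₀ : IsMixed μ₀) {ν₀ : β → ℝ} (hν₀ : IsMixed ν₀)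
    (hcol : ∀ j, v ≤ ∑ i, μ₀ i * u i j) (hrow : ∀ i, ∑ j, ν₀ j * u i j ≤ v) :
    gameValue u = v := by
  have hupper : ∀ μ : {μ : α → ℝ // IsMixed μ},
      ⨅ ν : {ν : β → ℝ // IsMixed ν}, EU u μ.1 ν.1 ≤ v := fun μ => by
    refine (ciInf_le (bddBelow_range_EU u μ.1) ⟨ν₀, hν₀⟩).trans ?_
    calc EU u μ.1 ν₀ = ∑ i, μ.1 i * ∑ j, ν₀ j * u i j := EU_eq_sum_row u μ.1 ν₀
      _ ≤ ∑ i, μ.1 i * v :=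
        Finset.sum_le_sum fun i _ => mul_le_mul_of_nonneg_left (hrow i) (μ.2.1 i)
      _ = v := by rw [← Finset.sum_mul, μ.2.2, one_mul]
  have : Nonempty {μ : α → ℝ // IsMixed μ} := ⟨⟨μ₀, hμ₀⟩⟩
  have : Nonempty {ν : β → ℝ // IsMixed ν} := ⟨⟨ν₀, hν₀⟩⟩
  refine le_antisymm (ciSup_le hupper) ?_
  refine le_ciSup_of_le ⟨v, Set.forall_mem_range.2 hupper⟩ ⟨μ₀, hμ₀⟩ (le_ciInf fun ν => ?_)
  calc v = ∑ j, ν.1 j * v := by rw [← Finset.sum_mul, ν.2.2, one_mul]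
    _ ≤ ∑ j, ν.1 j * ∑ i, μ₀ i * u i j :=
      Finset.sum_le_sum fun j _ => mul_le_mul_of_nonneg_left (hcol j) (ν.2.1 j)
    _ = EU u μ₀ ν.1 := (EU_eq_sum_col u μ₀ ν.1).symm

/-- The uniform distribution on a nonempty finite set is a mixed strategy. -/
theorem isMixed_uniform_s11 {α : Type*} [Fintype α] [DecidableEq α] {S : Finset α}
    (hS : S.Nonempty) : IsMixed fun i => if i ∈ S then (#S : ℝ)⁻¹ else 0 := by
  have hcard : (#S : ℝ) ≠ 0 := Nat.cast_ne_zero.2 hS.card_pos.ne'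
  refine ⟨fun i => ?_, ?_⟩
  · dsimp only
    split_ifs <;> positivity
  · simp [Finset.sum_ite_mem, hcard]

/-- If the rows in `S` have sum `r`, all other rows have sum at most `r`, and the columns
restricted to `S` have equal sums, then the value is `r` over the number of columns. -/
theorem gameValue_eq_div_of_balanced {α β : Type*} [Fintype α] [Fintype β] [Nonempty β]
    {u : α → β → ℝ} {S : Finset α} (hS : S.Nonempty) {r : ℝ}
    (hrow : ∀ i ∈ S, ∑ j, u i j = r) (hle : ∀ i, ∑ j, u i j ≤ r)
    (hcol : ∀ j j', ∑ i ∈ S, u i j = ∑ i ∈ S, u i j') :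
    gameValue u = r / Fintype.card β := by
  classical
  have hβ : (0 : ℝ) < Fintype.card β := Nat.cast_pos.2 Fintype.card_pos
  have hScard : (0 : ℝ) < #S := Nat.cast_pos.2 hS.card_pos
  refine gameValue_eq_of_guarantees (isMixed_uniform_s11 hS)
    (isMixed_uniform_s11 (Finset.univ_nonempty (α := β))) (fun j => ?_) (fun i => ?_)
  · have hcount : (Fintype.card β : ℝ) * ∑ i ∈ S, u i j = #S * r := by
      calc (Fintype.card β : ℝ) * ∑ i ∈ S, u i j = ∑ j', ∑ i ∈ S, u i j' := by
            simp [Finset.sum_congr rfl fun j' _ => hcol j' j]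
        _ = ∑ i ∈ S, ∑ j', u i j' := Finset.sum_comm
        _ = #S * r := by simp [Finset.sum_congr rfl hrow]
    simp only [ite_mul, zero_mul, Finset.sum_ite_mem, Finset.univ_inter, ← Finset.mul_sum]
    refine le_of_eq ?_
    field_simp
    linarith
  · simp only [Finset.mem_univ, if_true, ← Finset.mul_sum, Finset.card_univ]
    rw [inv_mul_eq_div]
    exact div_le_div_of_nonneg_right (hle i) hβ.le

/-- If the row submatrix `u'` of `u` induced by a nonempty set of rows `S` is
balanced and `rowmax(u) = rowmax(u')`, then `𝒱(u) = 𝒱(u')`. -/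
theorem value_eq_value_of_balanced_row_submatrix (m n : ℕ) (hm : 1 ≤ m) (hn : 1 ≤ n)
    (u : Fin m → Fin n → ℝ) (hu : ∀ i j, u i j = 0 ∨ u i j = 1)
    (S : Finset (Fin m)) (hS : S.Nonempty)
    (hrow : ∀ i ∈ S, ∀ i' ∈ S, ∑ j, u i j = ∑ j, u i' j)
    (hcol : ∀ j j' : Fin n, ∑ i ∈ S, u i j = ∑ i ∈ S, u i j')
    (hmax : (⨆ i : Fin m, ∑ j, u i j) = ⨆ i : {i : Fin m // i ∈ S}, ∑ j, u i.1 j) :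
    gameValue u = gameValue (fun (i : {i : Fin m // i ∈ S}) (j : Fin n) => u i.1 j) := by
  obtain ⟨i₀, hi₀⟩ := hS
  have : Nonempty (Fin n) := ⟨⟨0, hn⟩⟩
  have : Nonempty {i : Fin m // i ∈ S} := ⟨⟨i₀, hi₀⟩⟩
  have hrowS : ∀ i ∈ S, ∑ j, u i j = ∑ j, u i₀ j := fun i hi => hrow i hi i₀ hi₀
  have hsup : (⨆ i : {i : Fin m // i ∈ S}, ∑ j, u i.1 j) = ∑ j, u i₀ j := by
    simp only [fun i : {i : Fin m // i ∈ S} => hrowS i.1 i.2, ciSup_const]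
  have hle : ∀ i, ∑ j, u i j ≤ ∑ j, u i₀ j := fun i =>
    (le_ciSup (Set.finite_range fun i => ∑ j, u i j).bddAbove i).trans (hmax.trans hsup).le
  rw [gameValue_eq_div_of_balanced ⟨i₀, hi₀⟩ hrowS hle hcol]
  have hcolS : ∀ j j' : Fin n, ∑ i : {i : Fin m // i ∈ S}, u i.1 j =
      ∑ i : {i : Fin m // i ∈ S}, u i.1 j' := fun j j' => by
    rw [Finset.sum_coe_sort S fun i => u i j, Finset.sum_coe_sort S fun i => u i j']
    exact hcol j j'
  exact (gameValue_eq_div_of_balanced (u := fun (i : {i : Fin m // i ∈ S}) (j : Fin n) => u i.1 j)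
    (S := Finset.univ) Finset.univ_nonempty
    (fun i _ => hrowS i.1 i.2) (fun i => (hrowS i.1 i.2).le) hcolS).symm
end

section
/- (Proposition on balanced row submatrices, part 2.) Let u : Fin m → Fin n → ℝ be a matrix game with entries in {0,1} and let S ⊆ Fin m be a nonempty set of rows whose induced row submatrix u' is balanced, with rowmax(u) = rowmax(u'). Then the strategy profile (μ̄,ν̄) is an equilibrium in u, where μ̄ is Eloise's strategy assigning probability 1/|S| to each row in S and 0 to rows outside S, and ν̄ is Abelard's uniform strategy assigning 1/n to each column. -/
open Finset

/-- The expected utility grouped by rows, when Abelard plays a constant weight. -/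
theorem EU_const_right {α β : Type*} [Fintype α] [Fintype β]
    (u : α → β → ℝ) (μ : α → ℝ) (c : ℝ) :
    EU u μ (fun _ => c) = c * ∑ i, μ i * ∑ j, u i j := by
  simp only [EU, Finset.mul_sum]
  exact Finset.sum_congr rfl fun i _ => Finset.sum_congr rfl fun j _ => by ring

/-- The expected utility grouped by columns, when Eloise plays a constant weight on `S`. -/
theorem EU_indicator_left {α β : Type*} [Fintype α] [DecidableEq α] [Fintype β]
    (u : α → β → ℝ) (S : Finset α) (c : ℝ) (ν : β → ℝ) :
    EU u (fun i => if i ∈ S then c else 0) ν = c * ∑ j, ν j * ∑ i ∈ S, u i j := by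
  rw [EU, Finset.sum_comm, Finset.mul_sum]
  refine Finset.sum_congr rfl fun j _ => ?_
  simp only [ite_mul, zero_mul, Finset.sum_ite_mem, Finset.univ_inter, Finset.mul_sum]
  exact Finset.sum_congr rfl fun i _ => by ring

theorem isMixed_const {n : ℕ} (hn : 1 ≤ n) : IsMixed (fun _ : Fin n => (1 : ℝ) / n) := by
  have : (n : ℝ) ≠ 0 := by positivity
  exact ⟨fun _ => by positivity, by simp [this]⟩

theorem isMixed_indicator {α : Type*} [Fintype α] [DecidableEq α]
    {S : Finset α} (hS : S.Nonempty) :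
    IsMixed (fun i => if i ∈ S then (1 : ℝ) / S.card else 0) := by
  refine ⟨fun i => by dsimp only; split_ifs <;> positivity, ?_⟩
  simp [Finset.sum_ite_mem, hS.ne_empty]

/-- A mixed strategy averages any function constant on its support to that constant. -/
theorem IsMixed.sum_mul_eq {α : Type*} [Fintype α] {μ f : α → ℝ} (hμ : IsMixed μ) {r : ℝ}
    (hf : ∀ i, μ i ≠ 0 → f i = r) : ∑ i, μ i * f i = r := by
  have h : ∀ i, μ i * f i = μ i * r := fun i => by
    by_cases hi : μ i = 0
    · simp [hi]
    · rw [hf i hi]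
  simp only [h, ← Finset.sum_mul, hμ.2, one_mul]

theorem IsMixed.sum_mul_le {α : Type*} [Fintype α] {μ f : α → ℝ} (hμ : IsMixed μ) {r : ℝ}
    (hf : ∀ i, f i ≤ r) : ∑ i, μ i * f i ≤ r := by
  calc ∑ i, μ i * f i ≤ ∑ i, μ i * r :=
        Finset.sum_le_sum fun i _ => mul_le_mul_of_nonneg_left (hf i) (hμ.1 i)
    _ = r := by rw [← Finset.sum_mul, hμ.2, one_mul]

/-- If the row submatrix of `u` induced by a nonempty set of rows `S` is
balanced and `rowmax(u) = rowmax(u')`, then the profile `(μ̄, ν̄)` is an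
equilibrium in `u`, where `μ̄` is uniform on the rows in `S` (and `0` outside
`S`) and `ν̄` is Abelard's uniform strategy. -/
theorem uniform_equilibrium_of_balanced_row_submatrix (m n : ℕ) (hm : 1 ≤ m) (hn : 1 ≤ n)
    (u : Fin m → Fin n → ℝ) (hu : ∀ i j, u i j = 0 ∨ u i j = 1)
    (S : Finset (Fin m)) (hS : S.Nonempty)
    (hrow : ∀ i ∈ S, ∀ i' ∈ S, ∑ j, u i j = ∑ j, u i' j)
    (hcol : ∀ j j' : Fin n, ∑ i ∈ S, u i j = ∑ i ∈ S, u i j')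
    (hmax : (⨆ i : Fin m, ∑ j, u i j) = ⨆ i : {i : Fin m // i ∈ S}, ∑ j, u i.1 j) :
    (∀ μ' : Fin m → ℝ, IsMixed μ' →
        EU u μ' (fun _ => (1 : ℝ) / n)
          ≤ EU u (fun i => if i ∈ S then (1 : ℝ) / S.card else 0) (fun _ => (1 : ℝ) / n))
    ∧ (∀ ν' : Fin n → ℝ, IsMixed ν' →
        EU u (fun i => if i ∈ S then (1 : ℝ) / S.card else 0) (fun _ => (1 : ℝ) / n)
          ≤ EU u (fun i => if i ∈ S then (1 : ℝ) / S.card else 0) ν') := by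
  obtain ⟨i₀, hi₀⟩ := hS
  have : Nonempty {i : Fin m // i ∈ S} := ⟨⟨i₀, hi₀⟩⟩
  have hμ := isMixed_indicator ⟨i₀, hi₀⟩
  refine ⟨fun μ' hμ' => ?_, fun ν' hν' => ?_⟩
  · have hle : ∀ i, ∑ j, u i j ≤ ∑ j, u i₀ j := fun i => by
      refine (le_ciSup (f := fun i => ∑ j, u i j) (Set.finite_range _).bddAbove i).trans ?_
      rw [hmax]
      exact ciSup_le fun k => (hrow k.1 k.2 i₀ hi₀).le
    rw [EU_const_right, EU_const_right]
    refine mul_le_mul_of_nonneg_left ?_ (by positivity)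
    refine (hμ'.sum_mul_le hle).trans_eq (hμ.sum_mul_eq fun i hi => ?_).symm
    exact hrow i (by_contra fun h => hi (if_neg h)) i₀ hi₀
  · rw [EU_indicator_left, EU_indicator_left,
      (isMixed_const hn).sum_mul_eq fun j _ => hcol j ⟨0, hn⟩,
      hν'.sum_mul_eq fun j _ => hcol j ⟨0, hn⟩]
end
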